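/- Let n ≥ 1 and m ≥ 0 be natural numbers, let A be an invertible n×n matrix with rational entries, and let B be an n×m matrix with rational entries. Let μ₁,…,μₙ and δ₁,…,δₘ be complex numbers with μᵢ ≠ 0 for every i, satisfying the n linear relations ∑ⱼ Aᵢⱼ μⱼ + ∑ₖ Bᵢₖ δₖ = 0 for i = 1,…,n. Then 1 ≤ dim_ℚ (spanℚ{μ₁,…,μₙ} + spanℚ{δ₁,…,δₘ}) ≤ m, where the span is taken in ℂ regarded as a vector space over ℚ. In particular m ≥ dim_ℚ(∑ᵢ μᵢℚ + ∑ₖ δₖℚ) ≥ 1. -/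

import Mathlib

/-- If an invertible matrix sends a family of vectors into a submodule, then the family already
lies in that submodule. -/
theorem Matrix.mem_of_isUnit_of_forall_sum_smul_mem {ι R M : Type*} [Fintype ι] [DecidableEq ι]
    [Ring R] [AddCommGroup M] [Module R M] {A : Matrix ι ι R} (hA : IsUnit A)
    {N : Submodule R M} {v : ι → M} (h : ∀ i, ∑ j, A i j • v j ∈ N) (i : ι) : v i ∈ N := by
  obtain ⟨C, hC⟩ := hA.exists_left_inv
  have key : v i = ∑ k, C i k • ∑ j, A k j • v j := by
    calc v i = ∑ j, (C * A) i j • v j := by simp [hC, Matrix.one_apply, ite_smul]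
      _ = ∑ k, C i k • ∑ j, A k j • v j := by
        simp only [Matrix.mul_apply, Finset.sum_smul, Finset.smul_sum, mul_smul]
        exact Finset.sum_comm
  rw [key]
  exact N.sum_mem fun k _ => N.smul_mem _ (h k)

/-- Linear-algebraic core of Theorem 3.1 ("Número Separatrizes"): if the
intersection matrix `A` is invertible, the residues `μ i` are nonzero and
satisfy the relations `∑ j, A i j • μ j + ∑ k, B i k • δ k = 0`, then
`1 ≤ dim_ℚ (span ℚ {μ i} + span ℚ {δ k}) ≤ m`. -/
theorem number_of_separatrices
    (n m : ℕ) (hn : 1 ≤ n)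
    (A : Matrix (Fin n) (Fin n) ℚ) (hA : IsUnit A)
    (B : Matrix (Fin n) (Fin m) ℚ)
    (μ : Fin n → ℂ) (δ : Fin m → ℂ)
    (hμ : ∀ i, μ i ≠ 0)
    (hrel : ∀ i, (∑ j, (A i j : ℂ) * μ j) + (∑ k, (B i k : ℂ) * δ k) = 0) :
    1 ≤ Module.finrank ℚ
        ↥(Submodule.span ℚ (Set.range μ) ⊔ Submodule.span ℚ (Set.range δ)) ∧
    Module.finrank ℚ
        ↥(Submodule.span ℚ (Set.range μ) ⊔ Submodule.span ℚ (Set.range δ)) ≤ m := by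
  have hμ_mem : ∀ i, μ i ∈ Submodule.span ℚ (Set.range δ) := by
    refine Matrix.mem_of_isUnit_of_forall_sum_smul_mem hA fun i => ?_
    simp only [Rat.smul_def]
    rw [eq_neg_of_add_eq_zero_left (hrel i)]
    refine neg_mem (Submodule.sum_mem _ fun k _ => ?_)
    rw [← Rat.smul_def]
    exact Submodule.smul_mem _ _ (Submodule.subset_span ⟨k, rfl⟩)
  have hle : Submodule.span ℚ (Set.range μ) ≤ Submodule.span ℚ (Set.range δ) :=
    Submodule.span_le.2 (Set.range_subset_iff.2 hμ_mem)
  rw [sup_eq_right.2 hle]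
  constructor
  · have : FiniteDimensional ℚ (Submodule.span ℚ (Set.range δ)) :=
      FiniteDimensional.span_of_finite ℚ (Set.finite_range δ)
    rw [Submodule.one_le_finrank_iff]
    exact Submodule.ne_bot_iff _ |>.2 ⟨μ ⟨0, hn⟩, hμ_mem _, hμ _⟩
  · simpa [Set.finrank] using finrank_range_le_card (R := ℚ) δ
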